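/- arXiv:math/0512527 — 4 statements merged into one kernel-verified Lean document; each statement's English description precedes it below -/
import Mathlib

section
/- Let n ≥ 1 and let S ⊆ {0, 1, …, n−1} satisfy: (i) there is no index i with i ∈ S and i+1 ∈ S (no two adjacent indices both lie in S); (ii) every i ∈ {0,…,n−1} with i ∉ S has exactly two neighbors in S, where the neighbors of i are the elements of {i−1, i+1} ∩ {0,…,n−1}. Then n is odd, 0 ∈ S, n−1 ∈ S, and S is exactly the set of even indices {0, 2, 4, …, n−1}. -/
/-- An index with exactly two neighbours in `S` has both its predecessor and its successor
in `S`. -/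
theorem exists_pred_mem_and_succ_mem_of_ncard_eq_two {n i : ℕ} {S : Set ℕ}
    (h : ({j | j < n ∧ (j + 1 = i ∨ j = i + 1)} ∩ S).ncard = 2) :
    (∃ j ∈ S, j + 1 = i) ∧ i + 1 ∈ S := by
  obtain ⟨x, y, hxy, hset⟩ := Set.ncard_eq_two.mp h
  have hx : x ∈ {j | j < n ∧ (j + 1 = i ∨ j = i + 1)} ∩ S := by simp [hset]
  have hy : y ∈ {j | j < n ∧ (j + 1 = i ∨ j = i + 1)} ∩ S := by simp [hset]
  obtain ⟨⟨-, hx | rfl⟩, hxS⟩ := hx <;> obtain ⟨⟨-, hy | rfl⟩, hyS⟩ := hy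
  · omega
  · exact ⟨⟨x, hxS, hx⟩, hyS⟩
  · exact ⟨⟨y, hyS, hy⟩, hxS⟩
  · exact absurd rfl hxy

/-- Combinatorics of fixed curves in an `Aₙ` chain preserved by a non-symplectic involution:
if `S ⊆ {0,…,n-1}` contains no two adjacent indices, and every index not in `S` has exactly
two neighbours in `S` (neighbours of `i` being the elements of `{i-1, i+1} ∩ {0,…,n-1}`),
then `n` is odd, the two ends belong to `S`, and `S` is exactly the set of even indices. -/
theorem stmt_4 (n : ℕ) (hn : 1 ≤ n) (S : Set ℕ) (hSsub : ∀ i ∈ S, i < n)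
    (h1 : ¬∃ i, i ∈ S ∧ i + 1 ∈ S)
    (h2 : ∀ i < n, i ∉ S →
      ({j | j < n ∧ (j + 1 = i ∨ j = i + 1)} ∩ S).ncard = 2) :
    Odd n ∧ 0 ∈ S ∧ n - 1 ∈ S ∧ S = {i | i < n ∧ Even i} := by
  have key : ∀ i < n, i ∉ S → (∃ j ∈ S, j + 1 = i) ∧ i + 1 ∈ S := fun i hi hiS =>
    exists_pred_mem_and_succ_mem_of_ncard_eq_two (h2 i hi hiS)
  have mem_iff : ∀ i < n, (i ∈ S ↔ Even i) := by
    intro i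
    induction i with
    | zero =>
      intro h0
      refine iff_of_true ?_ Even.zero
      by_contra hS
      obtain ⟨⟨j, -, hj⟩, -⟩ := key 0 h0 hS
      omega
    | succ k ih =>
      intro hk
      rw [Nat.even_add_one, ← ih (by omega)]
      refine ⟨fun hS hkS => h1 ⟨k, hkS, hS⟩, fun hkS => (key k (by omega) hkS).2⟩
  have last_mem : n - 1 ∈ S := by
    by_contra hS
    have := hSsub _ (key (n - 1) (by omega) hS).2
    omega
  refine ⟨?_, (mem_iff 0 hn).mpr Even.zero, last_mem, ?_⟩
  · have := ((mem_iff (n - 1) (by omega)).mp last_mem).add_one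
    rwa [Nat.sub_add_cancel hn] at this
  · ext i
    exact ⟨fun hi => ⟨hSsub i hi, (mem_iff i (hSsub i hi)).mp hi⟩,
      fun hi => (mem_iff i hi.1).mpr hi.2⟩
end

section
/- Let p, q ≥ 1 and let T be the tree ('tripod') consisting of a center vertex c with three disjoint paths (legs) of lengths 1, p and q attached to it: T has 2 + p + q vertices, namely c, one leaf adjacent to c, a path a₁–a₂–…–a_p with a₁ adjacent to c, and a path b₁–b₂–…–b_q with b₁ adjacent to c. Then there is no set S of vertices of T such that: (i) no two vertices of S are adjacent, and (ii) every vertex of T not in S has exactly two neighbors in S. -/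
/-- Vertices of the tripod tree: the center `c`, a leaf adjacent to `c`, a leg `a₁,…,a_p`
and a leg `b₁,…,b_q`. -/
abbrev TripodV (p q : ℕ) := Unit ⊕ Unit ⊕ Fin p ⊕ Fin q

/-- Oriented edges of the tripod tree: `c`–leaf, `c`–`a₁`, `c`–`b₁`, `aᵢ`–`aᵢ₊₁`,
`bⱼ`–`bⱼ₊₁`. -/
def tripodEdge (p q : ℕ) : TripodV p q → TripodV p q → Prop
  | Sum.inl _, Sum.inr (Sum.inl _) => True
  | Sum.inl _, Sum.inr (Sum.inr (Sum.inl i)) => (i : ℕ) = 0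
  | Sum.inl _, Sum.inr (Sum.inr (Sum.inr j)) => (j : ℕ) = 0
  | Sum.inr (Sum.inr (Sum.inl i)), Sum.inr (Sum.inr (Sum.inl i')) => (i' : ℕ) = (i : ℕ) + 1
  | Sum.inr (Sum.inr (Sum.inr j)), Sum.inr (Sum.inr (Sum.inr j')) => (j' : ℕ) = (j : ℕ) + 1
  | _, _ => False

/-- Adjacency in the tripod tree (symmetrization of `tripodEdge`). -/
def tripodAdj (p q : ℕ) (u v : TripodV p q) : Prop :=
  tripodEdge p q u v ∨ tripodEdge p q v u

/-- There is no set `S` of vertices of the tripod tree such that no two vertices of `S`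
are adjacent and every vertex not in `S` has exactly two neighbours in `S`. -/
theorem stmt_5 (p q : ℕ) (hp : 1 ≤ p) (hq : 1 ≤ q) :
    ¬∃ S : Set (TripodV p q),
      (∀ u ∈ S, ∀ v ∈ S, ¬tripodAdj p q u v) ∧
      (∀ v, v ∉ S → ({u | tripodAdj p q v u} ∩ S).ncard = 2) := by
  rintro ⟨S, hS, hT⟩
  have mem_of_subsingleton (v) (h : ({u | tripodAdj p q v u} ∩ S).Subsingleton) : v ∈ S := by
    by_contra hv
    have := (Set.ncard_le_one h.finite).mpr fun a ha b hb => h ha hb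
    have := hT v hv
    lia
  have leaf_mem : Sum.inr (Sum.inl ()) ∈ S := by
    apply mem_of_subsingleton
    rintro (_ | _ | x | x) ⟨hx, -⟩ (_ | _ | y | y) ⟨hy, -⟩ <;>
      simp [tripodAdj, tripodEdge] at hx hy ⊢
  have center_notMem : Sum.inl () ∉ S := fun h =>
    hS _ h _ leaf_mem (by simp [tripodAdj, tripodEdge])
  have a_mem : Sum.inr (Sum.inr (Sum.inl ⟨0, hp⟩)) ∈ S := by
    apply mem_of_subsingleton
    rintro (_ | _ | x | x) ⟨hx, hxS⟩ (_ | _ | y | y) ⟨hy, hyS⟩ <;>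
      simp only [Set.mem_ofPred_eq, tripodAdj, tripodEdge, Sum.inr.injEq, Sum.inl.injEq,
        Fin.ext_iff, center_notMem, or_self, reduceCtorEq] at hx hxS hy hyS ⊢
    lia
  have b_mem : Sum.inr (Sum.inr (Sum.inr ⟨0, hq⟩)) ∈ S := by
    apply mem_of_subsingleton
    rintro (_ | _ | x | x) ⟨hx, hxS⟩ (_ | _ | y | y) ⟨hy, hyS⟩ <;>
      simp only [Set.mem_ofPred_eq, tripodAdj, tripodEdge, Sum.inr.injEq,
        Fin.ext_iff, center_notMem, or_self, reduceCtorEq] at hx hxS hy hyS ⊢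
    lia
  obtain ⟨x, y, -, hxy⟩ := Set.ncard_eq_two.mp (hT _ center_notMem)
  have key (u) (hu : tripodAdj p q (Sum.inl ()) u) (h : u ∈ S) : u = x ∨ u = y := by
    have : u ∈ ({x, y} : Set _) := hxy ▸ ⟨hu, h⟩
    simpa using this
  have h₁ := key _ (by simp [tripodAdj, tripodEdge]) leaf_mem
  have h₂ := key _ (by simp [tripodAdj, tripodEdge]) a_mem
  have h₃ := key _ (by simp [tripodAdj, tripodEdge]) b_mem
  grind
end

section
/- Let n ≥ 1 and set N = n(n+1)/2 + 1. For a vector x = (x₀,…,xₙ) ∈ ℂ^{n+1}, let Φ(x) ∈ ℂ^N be the vector whose coordinates are all products xᵢxⱼ with 0 ≤ i ≤ j ≤ n−1 together with xₙ². Then: (a) Φ(x) ≠ 0 whenever x ≠ 0, so Φ descends to a well-defined map ℙⁿ(ℂ) → ℙ^{N−1}(ℂ); and (b) for nonzero x, y ∈ ℂ^{n+1}, [Φ(x)] = [Φ(y)] holds if and only if [y] = [x] or [y] = [s(x)], where s(x₀,…,x_{n−1},xₙ) = (x₀,…,x_{n−1},−xₙ). That is, the map given by these degree-2 monomials identifies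 exactly the orbits of the symmetry s on ℙⁿ(ℂ). -/
/-- Index type for the degree-2 monomials `xᵢxⱼ` (`0 ≤ i ≤ j ≤ n-1`) together with `xₙ²`. -/
abbrev QuadIdx (n : ℕ) := {p : Fin n × Fin n // p.1 ≤ p.2} ⊕ Unit

/-- The map `Φ` sending `x ∈ ℂ^{n+1}` to the vector of all products `xᵢxⱼ`
(`0 ≤ i ≤ j ≤ n-1`) together with `xₙ²`. -/
def quadPhi (n : ℕ) (x : Fin (n + 1) → ℂ) : QuadIdx n → ℂ
  | Sum.inl p => x p.1.1.castSucc * x p.1.2.castSucc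
  | Sum.inr _ => x (Fin.last n) ^ 2

/-- The symmetry `s : (x₀,…,x_{n-1},xₙ) ↦ (x₀,…,x_{n-1},-xₙ)`. -/
def quadFlip (n : ℕ) (x : Fin (n + 1) → ℂ) : Fin (n + 1) → ℂ :=
  fun i => if i = Fin.last n then -x i else x i

theorem eq_or_eq_neg_of_forall_mul_eq {ι R : Type*} [CommRing R] [IsDomain R] {f g : ι → R}
    (h : ∀ i j, f i * f j = g i * g j) : f = g ∨ f = -g := by
  by_cases hg : g = 0
  · left
    ext i
    simpa [hg] using h i i
  · obtain ⟨k, hk⟩ := Function.ne_iff.mp hg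
    rcases mul_self_eq_mul_self_iff.mp (h k k) with hf | hf
    · left
      ext i
      apply mul_right_cancel₀ hk
      rw [← h i k, hf]
    · right
      ext i
      apply mul_right_cancel₀ hk
      have := h i k
      rw [hf] at this
      simp only [Pi.neg_apply]
      linear_combination -this

theorem card_quadIdx (n : ℕ) : Nat.card (QuadIdx n) = n * (n + 1) / 2 + 1 := by
  rw [Nat.card_sum, ← Nat.card_congr (Sym2.sortEquiv (α := Fin n)), Nat.card_eq_fintype_card,
    Sym2.card, Fintype.card_fin, Nat.choose_two_right, Nat.card_unique, Nat.add_sub_cancel,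
    mul_comm]

theorem quadPhi_smul (n : ℕ) (c : ℂ) (x : Fin (n + 1) → ℂ) :
    quadPhi n (c • x) = c ^ 2 • quadPhi n x := by
  ext (p | _) <;> simp only [quadPhi, Pi.smul_apply, smul_eq_mul] <;> ring

theorem quadPhi_quadFlip (n : ℕ) (x : Fin (n + 1) → ℂ) :
    quadPhi n (quadFlip n x) = quadPhi n x := by
  ext (p | _) <;> simp [quadPhi, quadFlip, Fin.castSucc_ne_last]

theorem eq_zero_of_quadPhi_eq_zero {n : ℕ} {x : Fin (n + 1) → ℂ} (h : quadPhi n x = 0) :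
    x = 0 := by
  ext i
  induction i using Fin.lastCases with
  | last => simpa [quadPhi] using congrFun h (Sum.inr ())
  | cast i => simpa [quadPhi] using congrFun h (Sum.inl ⟨(i, i), le_rfl⟩)

theorem eq_or_eq_of_quadPhi_eq {n : ℕ} {x z : Fin (n + 1) → ℂ} (h : quadPhi n z = quadPhi n x) :
    ∃ ε : ℂ, z = ε • x ∨ z = ε • quadFlip n x := by
  have hmul (i j : Fin n) : z i.castSucc * z j.castSucc = x i.castSucc * x j.castSucc := by
    rcases le_total i j with hij | hij
    · exact congrFun h (Sum.inl ⟨(i, j), hij⟩)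
    · rw [mul_comm, mul_comm (x _)]
      exact congrFun h (Sum.inl ⟨(j, i), hij⟩)
  have hlast : z (Fin.last n) = x (Fin.last n) ∨ z (Fin.last n) = -x (Fin.last n) :=
    sq_eq_sq_iff_eq_or_eq_neg.mp (congrFun h (Sum.inr ()))
  have hflip : quadFlip n x (Fin.last n) = -x (Fin.last n) := by simp [quadFlip]
  have hflip' (i : Fin n) : quadFlip n x i.castSucc = x i.castSucc := by
    simp [quadFlip, Fin.castSucc_ne_last]
  rcases eq_or_eq_neg_of_forall_mul_eq (f := fun i : Fin n => z i.castSucc)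
    (g := fun i : Fin n => x i.castSucc) hmul with hc | hc
  · have hc' (i : Fin n) : z i.castSucc = x i.castSucc := congrFun hc i
    refine ⟨1, hlast.imp (fun hl => ?_) fun hl => ?_⟩ <;> ext i <;>
      induction i using Fin.lastCases <;> simp [*]
  · have hc' (i : Fin n) : z i.castSucc = -x i.castSucc := congrFun hc i
    refine ⟨-1, hlast.symm.imp (fun hl => ?_) fun hl => ?_⟩ <;> ext i <;>
      induction i using Fin.lastCases <;> simp [*]

/-- The index set has cardinality `N = n(n+1)/2 + 1`, `Φ(x) ≠ 0` for `x ≠ 0` (so `Φ`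
descends to projective space), and `[Φ(x)] = [Φ(y)]` iff `[y] = [x]` or `[y] = [s(x)]`:
the map given by these degree-2 monomials identifies exactly the orbits of the symmetry
`s` on `ℙⁿ(ℂ)`. -/
theorem stmt_10 (n : ℕ) (hn : 1 ≤ n) :
    Nat.card (QuadIdx n) = n * (n + 1) / 2 + 1 ∧
    (∀ x : Fin (n + 1) → ℂ, x ≠ 0 → quadPhi n x ≠ 0) ∧
    (∀ (x y : Fin (n + 1) → ℂ) (hx : x ≠ 0) (hy : y ≠ 0)
        (hpx : quadPhi n x ≠ 0) (hpy : quadPhi n y ≠ 0) (hsx : quadFlip n x ≠ 0),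
      (Projectivization.mk ℂ (quadPhi n x) hpx = Projectivization.mk ℂ (quadPhi n y) hpy ↔
        Projectivization.mk ℂ y hy = Projectivization.mk ℂ x hx ∨
        Projectivization.mk ℂ y hy = Projectivization.mk ℂ (quadFlip n x) hsx)) := by
  refine ⟨card_quadIdx n, fun x hx h => hx (eq_zero_of_quadPhi_eq_zero h), ?_⟩
  intro x y hx hy hpx hpy hsx
  constructor
  · simp only [Projectivization.mk_eq_mk_iff']
    rintro ⟨a, ha⟩
    obtain ⟨c, rfl⟩ := IsAlgClosed.exists_pow_nat_eq a two_pos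
    rw [← quadPhi_smul] at ha
    have hc : c ≠ 0 := by
      rintro rfl
      apply hpx
      rw [← ha, quadPhi_smul]
      simp
    obtain ⟨ε, h⟩ := eq_or_eq_of_quadPhi_eq ha
    refine h.imp (fun h => ⟨c⁻¹ * ε, ?_⟩) fun h => ⟨c⁻¹ * ε, ?_⟩ <;>
      rw [mul_smul, ← h, inv_smul_smul₀ hc]
  · rw [eq_comm (a := Projectivization.mk ℂ (quadPhi n x) hpx)]
    simp only [Projectivization.mk_eq_mk_iff']
    rintro (⟨a, rfl⟩ | ⟨a, rfl⟩)
    · exact ⟨a ^ 2, (quadPhi_smul n a x).symm⟩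
    · exact ⟨a ^ 2, by rw [quadPhi_smul, quadPhi_quadFlip]⟩
end

section
/- Let d ≥ 2 and let C ⊆ ℙ(ℂ^{d+1}) be the standard rational normal curve of degree d, i.e., the set of points [x^d : x^{d−1}y : x^{d−2}y² : … : y^d] for (x,y) ∈ ℂ² \ {0}. Suppose f is a linear automorphism of ℂ^{d+1} with f ∘ f = id such that one of the two eigenspaces ker(f − id), ker(f + id) is one-dimensional and the other is d-dimensional, and suppose the induced map σ on ℙ(ℂ^{d+1}) (σ[v] = [f v]) maps C onto C. Then d = 2, and the point O of ℙ(ℂ^{d+1}) corresponding to the one-dimensional eigenspace does not lie on C. -/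
/-- The standard rational normal curve of degree `d` in `ℙ(ℂ^{d+1})`: the set of points
`[x^d : x^{d-1}y : … : y^d]`. -/
def stdRNC (d : ℕ) : Set (Projectivization ℂ (Fin (d + 1) → ℂ)) :=
  {P | ∃ (v : Fin (d + 1) → ℂ) (hv : v ≠ 0), P = Projectivization.mk ℂ v hv ∧
    ∃ x y : ℂ, ∀ i : Fin (d + 1), v i = x ^ (d - (i : ℕ)) * y ^ (i : ℕ)}

open Polynomial in
/-- A nonzero linear functional vanishes at only finitely many points `(1, t, …, t ^ d)` of the
moment curve. -/
theorem finite_setOf_dual_moment_eq_zero {d : ℕ} (χ : (Fin (d + 1) → ℂ) →ₗ[ℂ] ℂ) (hχ : χ ≠ 0) :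
    {t : ℂ | χ (fun i => t ^ (i : ℕ)) = 0}.Finite := by
  have hχ_apply (w : Fin (d + 1) → ℂ) : χ w = ∑ i, w i * χ (Pi.single i 1) := by
    conv_lhs => rw [pi_eq_sum_univ' w]
    simp
  set p : ℂ[X] := ∑ i : Fin (d + 1), monomial (i : ℕ) (χ (Pi.single i 1)) with hp
  have hp_eval (t : ℂ) : p.eval t = χ (fun i => t ^ (i : ℕ)) := by
    rw [hχ_apply, hp, eval_finsetSum]
    simp [eval_monomial, mul_comm]
  have hp_ne : p ≠ 0 := by
    intro h
    refine hχ (LinearMap.ext fun w => ?_)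
    have hcoeff (i : Fin (d + 1)) : χ (Pi.single i 1) = 0 := by
      have := congrArg (fun q => coeff q (i : ℕ)) h
      simpa [hp, coeff_monomial, Fin.val_inj] using this
    rw [hχ_apply]
    simp [hcoeff]
  refine (finite_setOfPred_isRoot hp_ne).subset fun t ht => ?_
  simpa [IsRoot, hp_eval] using ht

open Polynomial in
/-- In dimension at least four, if nonzero multiples of `u` lie on the chords of the moment curve
through `p, p'` and through `q, q'`, then these four parameters are not all distinct. -/
theorem eq_or_eq_of_mem_two_moment_chords {d : ℕ} (hd : 3 ≤ d) {u : Fin (d + 1) → ℂ}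
    {a a' b b' k l p p' q q' : ℂ} (ha : a ≠ 0) (hl : l ≠ 0)
    (hp : ∀ i : Fin (d + 1), a * u i = b * p ^ (i : ℕ) + k * p' ^ (i : ℕ))
    (hq : ∀ i : Fin (d + 1), a' * u i = l * q ^ (i : ℕ) + b' * q' ^ (i : ℕ)) :
    q = p ∨ q = p' ∨ q = q' := by
  set P : ℂ[X] := (X - C p) * (X - C p') * (X - C q') with hP
  have hdeg : P.natDegree < d + 1 := by
    have : P.natDegree ≤ 3 := by rw [hP]; compute_degree
    omega
  have heval (t : ℂ) : ∑ i : Fin (d + 1), P.coeff i * t ^ (i : ℕ) = P.eval t := by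
    rw [eval_eq_sum_range' hdeg, Finset.sum_range]
  have hpair {c x y m n : ℂ}
      (h : ∀ i : Fin (d + 1), c * u i = m * x ^ (i : ℕ) + n * y ^ (i : ℕ)) :
      c * ∑ i : Fin (d + 1), P.coeff i * u i = m * P.eval x + n * P.eval y := by
    rw [← heval, ← heval, Finset.mul_sum, Finset.mul_sum, Finset.mul_sum,
      ← Finset.sum_add_distrib]
    refine Finset.sum_congr rfl fun i _ => ?_
    linear_combination P.coeff i * h i
  have hu : ∑ i : Fin (d + 1), P.coeff i * u i = 0 := by
    have := hpair hp
    simpa [hP, ha] using this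
  have := hpair hq
  rw [hu] at this
  simpa [hP, hl, sub_eq_zero, or_assoc] using this

/-- If a perturbation of a nonzero scalar by a rank-one map with image spanned by `u` preserves the
rational normal curve, then for all but finitely many `t` the image of the point with parameter `t`
is a point with parameter `s ≠ t`. -/
theorem exists_moment_image {d : ℕ} (hd : 2 ≤ d) (f : (Fin (d + 1) → ℂ) →ₗ[ℂ] (Fin (d + 1) → ℂ))
    (hf : Function.Surjective f) {ε : ℂ} {u : Fin (d + 1) → ℂ}
    (hrank : ∀ v, ∃ a : ℂ, f v = ε • v + a • u) (hne : f ≠ ε • LinearMap.id)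
    (hcurve : ∀ t : ℂ, ∃ k x y : ℂ, ∀ i : Fin (d + 1),
      f (fun i => t ^ (i : ℕ)) i = k * (x ^ (d - (i : ℕ)) * y ^ (i : ℕ)))
    {S : Set ℂ} (hS : S.Finite) :
    ∃ t ∉ S, ∃ s k a : ℂ, s ≠ t ∧ k ≠ 0 ∧ a ≠ 0 ∧
      ∀ i : Fin (d + 1), a * u i = k * s ^ (i : ℕ) + -ε * t ^ (i : ℕ) := by
  obtain ⟨j, hj⟩ : ∃ j, LinearMap.proj j ∘ₗ (f - ε • LinearMap.id) ≠ 0 := by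
    by_contra! h
    refine hne (sub_eq_zero.mp (LinearMap.ext fun v => funext fun j => ?_))
    exact LinearMap.congr_fun (h j) v
  have h_zero : LinearMap.proj 0 ∘ₗ f ≠ 0 := by
    intro h
    obtain ⟨v, hv⟩ := hf (fun _ => 1)
    simpa [hv] using LinearMap.congr_fun h v
  have h_line : {t : ℂ | ∃ b : ℂ, ∀ i : Fin (d + 1), t ^ (i : ℕ) = b * u i}.Finite := by
    refine Set.Subsingleton.finite ?_
    rintro t ⟨b, hb⟩ s ⟨c, hc⟩
    have hb0 := hb 0
    have hc0 := hc 0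
    have hb1 := hb ⟨1, by omega⟩
    have hc1 := hc ⟨1, by omega⟩
    simp only [Fin.val_zero, pow_zero, pow_one] at hb0 hc0 hb1 hc1
    have hu : u 0 ≠ 0 := by rintro h; simp [h] at hb0
    have : b = c := mul_right_cancel₀ hu (hb0.symm.trans hc0)
    rw [hb1, hc1, this]
  obtain ⟨t, ht⟩ := (((hS.union (finite_setOf_dual_moment_eq_zero _ hj)).union
    (finite_setOf_dual_moment_eq_zero _ h_zero)).union h_line).infinite_compl.nonempty
  simp only [Set.mem_compl_iff, Set.mem_union, Set.mem_ofPred_eq, not_or] at ht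
  obtain ⟨⟨⟨htS, htj⟩, ht0⟩, htu⟩ := ht
  obtain ⟨a, ha⟩ := hrank (fun i => t ^ (i : ℕ))
  obtain ⟨k, x, y, hk⟩ := hcurve t
  have hk0 : k * x ^ d ≠ 0 := by
    have := hk 0
    simp only [Fin.val_zero, Nat.sub_zero, pow_zero, mul_one] at this
    rw [← this]
    simpa using ht0
  have hx : x ≠ 0 := by
    rintro rfl
    simp [show d ≠ 0 by omega] at hk0
  have ha0 : a ≠ 0 := by
    rintro rfl
    simp [ha] at htj
  have hrel (i : Fin (d + 1)) :
      a * u i = k * x ^ d * (y / x) ^ (i : ℕ) + -ε * t ^ (i : ℕ) := by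
    have h₁ := hk i
    rw [ha] at h₁
    simp only [Pi.add_apply, Pi.smul_apply, smul_eq_mul] at h₁
    have h₂ : x ^ d * (y / x) ^ (i : ℕ) = x ^ (d - (i : ℕ)) * y ^ (i : ℕ) := by
      rw [div_pow, ← pow_sub_mul_pow x (Nat.lt_succ_iff.mp i.isLt)]
      field_simp
    linear_combination h₁ - k * h₂
  refine ⟨t, htS, y / x, k * x ^ d, a, ?_, hk0, ha0, hrel⟩
  intro hst
  rw [hst] at hrel
  by_cases hm : k * x ^ d - ε = 0
  · have hu : u = 0 := by
      funext i
      have : a * u i = 0 := by linear_combination hrel i + t ^ (i : ℕ) * hm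
      simpa [ha0] using this
    exact htj (by simp [ha, hu])
  · refine htu ⟨a / (k * x ^ d - ε), fun i => ?_⟩
    field_simp
    linear_combination - hrel i

/-- A perturbation of a nonzero scalar by a rank-one map with image spanned by `u` can preserve the
rational normal curve of degree `d` only if `d = 2` and `u` is not on the curve. -/
theorem eq_two_and_center_notMem_of_preserves {d : ℕ} (hd : 2 ≤ d)
    (f : (Fin (d + 1) → ℂ) →ₗ[ℂ] (Fin (d + 1) → ℂ))
    (hf : Function.Surjective f) {ε : ℂ} (hε : ε ≠ 0) {u : Fin (d + 1) → ℂ}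
    (hrank : ∀ v, ∃ a : ℂ, f v = ε • v + a • u) (hne : f ≠ ε • LinearMap.id)
    (hcurve : ∀ t : ℂ, ∃ k x y : ℂ, ∀ i : Fin (d + 1),
      f (fun i => t ^ (i : ℕ)) i = k * (x ^ (d - (i : ℕ)) * y ^ (i : ℕ))) :
    d = 2 ∧ ∀ k x y : ℂ, ¬ ∀ i : Fin (d + 1), u i = k * (x ^ (d - (i : ℕ)) * y ^ (i : ℕ)) := by
  obtain ⟨p, -, p', k, a, hpp', hk, ha, hp⟩ :=
    exists_moment_image hd f hf hrank hne hcurve Set.finite_empty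
  constructor
  · by_contra hd2
    obtain ⟨q, hqS, q', l, b, hqq', hl, hb, hq⟩ :=
      exists_moment_image hd f hf hrank hne hcurve (Set.toFinite {p, p'})
    simp only [Set.mem_insert_iff, Set.mem_singleton_iff, not_or] at hqS
    rcases eq_or_eq_of_mem_two_moment_chords (by omega) ha (neg_ne_zero.mpr hε)
      (fun i => (hp i).trans (add_comm _ _)) (fun i => (hq i).trans (add_comm _ _))
      with h | h | h
    · exact hqS.1 h
    · exact hqS.2 h
    · exact hqq' h.symm
  · intro m x y hu
    have h0 := hp 0
    have h1 := hp ⟨1, by omega⟩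
    have h2 := hp ⟨2, by omega⟩
    rw [hu] at h0 h1 h2
    obtain ⟨e, rfl⟩ := Nat.exists_eq_add_of_le' hd
    simp only [Fin.val_zero, Nat.sub_zero, pow_zero, mul_one, pow_one, Nat.add_sub_cancel,
      show e + 2 - 1 = e + 1 by omega] at h0 h1 h2
    have key : k * ε * (p - p') ^ 2 = 0 := by
      have : (k + -ε) * (k * p' ^ 2 + -ε * p ^ 2) = (k * p' + -ε * p) ^ 2 := by
        rw [← h0, ← h1, ← h2]
        ring
      linear_combination -this
    simp [hk, hε, sub_eq_zero, hpp'.symm] at key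

/-- A linear map inducing a self-map of the rational normal curve sends points of the moment curve
to multiples of points of the curve. -/
theorem exists_apply_moment_eq {d : ℕ} (f : (Fin (d + 1) → ℂ) →ₗ[ℂ] (Fin (d + 1) → ℂ))
    (hf : Function.Injective f)
    (hC : Set.MapsTo (Projectivization.map f hf) (stdRNC d) (stdRNC d)) (t : ℂ) :
    ∃ k x y : ℂ, ∀ i : Fin (d + 1),
      f (fun i => t ^ (i : ℕ)) i = k * (x ^ (d - (i : ℕ)) * y ^ (i : ℕ)) := by
  have hc : (fun i : Fin (d + 1) => t ^ (i : ℕ)) ≠ 0 := fun h => by simpa using congrFun h 0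
  obtain ⟨w, hw, hmk, x, y, hxy⟩ := hC ⟨_, hc, rfl, 1, t, by simp⟩
  rw [Projectivization.map_mk, Projectivization.mk_eq_mk_iff'] at hmk
  obtain ⟨k, hk⟩ := hmk
  exact ⟨k, x, y, fun i => by rw [← hk, ← hxy]; rfl⟩

/-- The case of a symmetry that is `ε` on a hyperplane and `-ε` on a line. -/
theorem eq_two_and_center_notMem_stdRNC {d : ℕ} (hd : 2 ≤ d)
    (f : (Fin (d + 1) → ℂ) ≃ₗ[ℂ] (Fin (d + 1) → ℂ)) {ε : ℂ} (hε : ε ≠ 0)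
    (hdim : Module.finrank ℂ (LinearMap.ker (f.toLinearMap - ε • LinearMap.id)) = d)
    (hC : Set.MapsTo (Projectivization.map f.toLinearMap f.injective) (stdRNC d) (stdRNC d)) :
    d = 2 ∧ ∀ (v : Fin (d + 1) → ℂ) (hv : v ≠ 0), f v = -ε • v →
      Projectivization.mk ℂ v hv ∉ stdRNC d := by
  set g := f.toLinearMap - ε • LinearMap.id with hg
  have hrange : Module.finrank ℂ (LinearMap.range g) = 1 := by
    have := g.finrank_range_add_finrank_ker
    rw [hdim, Module.finrank_fin_fun] at this
    omega
  obtain ⟨⟨u, hu⟩, hu0, hspan⟩ := finrank_eq_one_iff'.mp hrange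
  have hspan' (v : Fin (d + 1) → ℂ) : ∃ a : ℂ, a • u = g v := by
    obtain ⟨a, ha⟩ := hspan ⟨g v, v, rfl⟩
    exact ⟨a, congrArg Subtype.val ha⟩
  have hne : f.toLinearMap ≠ ε • LinearMap.id := by
    intro h
    rw [hg, h, sub_self, LinearMap.range_zero, finrank_bot] at hrange
    exact zero_ne_one hrange
  obtain ⟨hd2, hcenter⟩ := eq_two_and_center_notMem_of_preserves hd f.toLinearMap f.surjective hε
    (u := u) (fun v => (hspan' v).imp fun a ha => by simp [ha, hg]) hne
    (exists_apply_moment_eq _ f.injective hC)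
  refine ⟨hd2, ?_⟩
  rintro v hv hfv ⟨w, hw, hmk, x, y, hxy⟩
  obtain ⟨c, rfl⟩ := (Projectivization.mk_eq_mk_iff' ℂ v w hv hw).mp hmk
  obtain ⟨a, ha⟩ := hspan' (c • w)
  have hau : a • u = (-2 * ε * c) • w := by
    rw [ha, hg, LinearMap.sub_apply, LinearEquiv.coe_coe, hfv]
    simp only [LinearMap.smul_apply, LinearMap.id_apply]
    module
  have hc : c ≠ 0 := by rintro rfl; simp at hv
  have ha0 : a ≠ 0 := by
    rintro rfl
    simp [hε, hc, hw, eq_comm] at hau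
  refine hcenter (-2 * ε * c / a) x y fun i => ?_
  rw [← hxy]
  have := congrFun hau i
  simp only [Pi.smul_apply, smul_eq_mul] at this
  field_simp
  linear_combination this

/-- If a point–hyperplane symmetry of `ℙ^d(ℂ)` (induced by a linear involution `f` whose
`±1`-eigenspaces have dimensions `1` and `d`) maps the rational normal curve of degree `d`
onto itself, then `d = 2` and the center `O` (the point of the one-dimensional eigenspace)
does not lie on the curve. -/
theorem stmt_12 (d : ℕ) (hd : 2 ≤ d)
    (f : (Fin (d + 1) → ℂ) ≃ₗ[ℂ] (Fin (d + 1) → ℂ))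
    (hinv : ∀ v, f (f v) = v)
    (hdim :
      (Module.finrank ℂ (LinearMap.ker (f.toLinearMap - LinearMap.id)) = 1 ∧
        Module.finrank ℂ (LinearMap.ker (f.toLinearMap + LinearMap.id)) = d) ∨
      (Module.finrank ℂ (LinearMap.ker (f.toLinearMap - LinearMap.id)) = d ∧
        Module.finrank ℂ (LinearMap.ker (f.toLinearMap + LinearMap.id)) = 1))
    (hC : Projectivization.map f.toLinearMap f.injective '' stdRNC d = stdRNC d) :
    d = 2 ∧
    ∀ (v : Fin (d + 1) → ℂ) (hv : v ≠ 0),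
      ((Module.finrank ℂ (LinearMap.ker (f.toLinearMap - LinearMap.id)) = 1 ∧
          v ∈ LinearMap.ker (f.toLinearMap - LinearMap.id)) ∨
       (Module.finrank ℂ (LinearMap.ker (f.toLinearMap + LinearMap.id)) = 1 ∧
          v ∈ LinearMap.ker (f.toLinearMap + LinearMap.id))) →
      Projectivization.mk ℂ v hv ∉ stdRNC d := by
  have hmaps := Set.mapsTo_iff_image_subset.mpr hC.subset
  have hsub : f.toLinearMap - (1 : ℂ) • LinearMap.id = f.toLinearMap - LinearMap.id := by
    rw [one_smul]
  have hadd : f.toLinearMap - (-1 : ℂ) • LinearMap.id = f.toLinearMap + LinearMap.id := by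
    module
  rcases hdim with ⟨h₁, h₂⟩ | ⟨h₁, h₂⟩
  · obtain ⟨hd2, hcenter⟩ := eq_two_and_center_notMem_stdRNC hd f (ε := -1) (by simp)
      (by rw [hadd, h₂]) hmaps
    refine ⟨hd2, fun v hv h => hcenter v hv ?_⟩
    rcases h with ⟨-, h⟩ | ⟨h, -⟩
    · simpa [sub_eq_zero] using h
    · omega
  · obtain ⟨hd2, hcenter⟩ := eq_two_and_center_notMem_stdRNC hd f (ε := 1) (by simp)
      (by rw [hsub, h₁]) hmaps
    refine ⟨hd2, fun v hv h => hcenter v hv ?_⟩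
    rcases h with ⟨h, -⟩ | ⟨-, h⟩
    · omega
    · simpa [add_eq_zero_iff_eq_neg] using h
end
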